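/- Every K-ambiguous weighted automaton A over an arbitrary weight set R can be decomposed into K unambiguous weighted automata B₁,…,B_K such that for every nonempty word u, the multiset of weight sequences of accepting runs of A on u equals the disjoint (multiset) union of the multisets of weight sequences of the B_i on u. Moreover, if A is aperiodic then each B_i can be chosen aperiodic. -/

import Mathlib

variable {Q Q' A R : Type*}

/-- `RunFrom Δ p w ρ`: `ρ` is the list of states visited after `p` along a run
reading `w` that starts in `p`. -/
def RunFrom (Δ : Q → A → Q → Prop) : Q → List A → List Q → Prop
  | _, [], [] => True
  | p, a :: w, q :: ρ => Δ p a q ∧ RunFrom Δ q w ρ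
  | _, _, _ => False

/-- There is a run from `p` to `q` reading `w`. -/
def HasRun (Δ : Q → A → Q → Prop) (p : Q) (w : List A) (q : Q) : Prop :=
  ∃ ρ, RunFrom Δ p w ρ ∧ (p :: ρ).getLast (List.cons_ne_nil _ _) = q

/-- `m`-fold power of a word. -/
def wpow (u : List A) (m : ℕ) : List A := (List.replicate m u).flatten

/-- Aperiodicity of a nondeterministic automaton. -/
def Aperiodic (Δ : Q → A → Q → Prop) : Prop :=
  ∃ m, 1 ≤ m ∧ ∀ (p q : Q) (u : List A), u ≠ [] →
    (HasRun Δ p (wpow u m) q ↔ HasRun Δ p (wpow u (m + 1)) q)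

/-- `p` and `q` are in the same strongly connected component. -/
def SameSCC (Δ : Q → A → Q → Prop) (p q : Q) : Prop :=
  p = q ∨ ((∃ u : List A, u ≠ [] ∧ HasRun Δ p u q) ∧ (∃ v : List A, v ≠ [] ∧ HasRun Δ q v p))

/-- The automaton is unambiguous from `p` to `q`. -/
def UnambFromTo (Δ : Q → A → Q → Prop) (p q : Q) : Prop :=
  ∀ (u : List A) (ρ₁ ρ₂ : List Q), u ≠ [] →
    RunFrom Δ p u ρ₁ → RunFrom Δ p u ρ₂ →
    (p :: ρ₁).getLast (List.cons_ne_nil _ _) = q →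
    (p :: ρ₂).getLast (List.cons_ne_nil _ _) = q → ρ₁ = ρ₂

def SCCUnambiguous (Δ : Q → A → Q → Prop) : Prop :=
  ∀ p q : Q, SameSCC Δ p q → UnambFromTo Δ p q

/-- The set of accepting runs on `w`, represented as pairs of an initial state and
the list of subsequently visited states. -/
def AccRuns (Δ : Q → A → Q → Prop) (I F : Set Q) (w : List A) : Set (Q × List Q) :=
  {x | x.1 ∈ I ∧ RunFrom Δ x.1 w x.2 ∧ (x.1 :: x.2).getLast (List.cons_ne_nil _ _) ∈ F}

/-- The sequence of weights along a run. -/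
def wgtSeq (wgt : Q → A → Q → R) : Q → List A → List Q → List R
  | p, a :: w, q :: ρ => wgt p a q :: wgtSeq wgt q w ρ
  | _, _, _ => []


/-- Accepting runs on `w` whose weight sequence is `s`. -/
def AccRunsW (Δ : Q → A → Q → Prop) (wgt : Q → A → Q → R) (I F : Set Q)
    (w : List A) (s : List R) : Set (Q × List Q) :=
  {x | x ∈ AccRuns Δ I F w ∧ wgtSeq wgt x.1 w x.2 = s}

open scoped Classical in
/-- Transition matrix of a letter. -/
noncomputable def letMat {Q A : Type} (Δ : Q → A → Q → Prop) (a : A) : Matrix Q Q ℕ :=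
  fun x y => if Δ x a y then 1 else 0

/-- Matrix counting runs on a word. -/
noncomputable def wMat {Q A : Type} [Fintype Q] [DecidableEq Q] (Δ : Q → A → Q → Prop)
    (w : List A) : Matrix Q Q ℕ := (w.map (letMat Δ)).prod

/-- Last state of a run. -/
def endSt {Q : Type} : Q → List Q → Q
  | p, [] => p
  | _, q :: ρ => endSt q ρ

open scoped Classical in
/-- Indicator of the elements of `P` below `q`. -/
noncomputable def belowV {Q : Type} (e : Q → ℕ) (P : Q → Prop) (q : Q) : Q → ℕ :=
  fun y => if P y ∧ e y < e q then 1 else 0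

/-- For each state, the number of runs smaller than the given run and ending there. -/
noncomputable def lessV {Q A : Type} [Fintype Q] [DecidableEq Q] (Δ : Q → A → Q → Prop)
    (e : Q → ℕ) : Q → List A → List Q → (Q → ℕ)
  | p, a :: w, q :: ρ =>
      Matrix.vecMul (belowV e (Δ p a) q) (wMat Δ w) + lessV Δ e q w ρ
  | _, _, _ => 0

open scoped Classical in
/-- Indicator of equality. -/
noncomputable def eqV {Q : Type} (x y : Q) : ℕ := if x = y then 1 else 0

section Basic
variable {Q A : Type}

theorem endSt_eq (p : Q) (ρ : List Q) :
    (p :: ρ).getLast (List.cons_ne_nil _ _) = endSt p ρ := by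
  induction ρ generalizing p with
  | nil => rfl
  | cons q ρ ih => rw [List.getLast_cons (List.cons_ne_nil _ _), ih]; rfl

theorem endSt_append (p : Q) (ρ σ : List Q) : endSt p (ρ ++ σ) = endSt (endSt p ρ) σ := by
  induction ρ generalizing p with
  | nil => rfl
  | cons q ρ ih => exact ih q

theorem run_append (Δ : Q → A → Q → Prop) (p : Q) (w v : List A) (ρ : List Q) :
    RunFrom Δ p (w ++ v) ρ ↔ ∃ ρ₁ ρ₂, ρ = ρ₁ ++ ρ₂ ∧ RunFrom Δ p w ρ₁ ∧
      RunFrom Δ (endSt p ρ₁) v ρ₂ := by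
  induction w generalizing p ρ with
  | nil =>
    constructor
    · intro h; exact ⟨[], ρ, rfl, trivial, h⟩
    · rintro ⟨ρ₁, ρ₂, rfl, h1, h2⟩
      cases ρ₁ with
      | nil => exact h2
      | cons _ _ => exact h1.elim
  | cons a w ih =>
    constructor
    · intro h
      cases ρ with
      | nil => exact h.elim
      | cons q ρ =>
        obtain ⟨h1, h2⟩ := h
        obtain ⟨ρ₁, ρ₂, rfl, h3, h4⟩ := (ih q ρ).1 h2
        exact ⟨q :: ρ₁, ρ₂, rfl, ⟨h1, h3⟩, h4⟩
    · rintro ⟨ρ₁, ρ₂, rfl, h1, h2⟩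
      cases ρ₁ with
      | nil => exact h1.elim
      | cons q ρ₁ => exact ⟨h1.1, (ih q _).2 ⟨ρ₁, ρ₂, rfl, h1.2, h2⟩⟩

theorem run_length (Δ : Q → A → Q → Prop) (p : Q) (w : List A) (ρ : List Q)
    (h : RunFrom Δ p w ρ) : ρ.length = w.length := by
  induction w generalizing p ρ with
  | nil => cases ρ with
    | nil => rfl
    | cons _ _ => exact h.elim
  | cons a w ih => cases ρ with
    | nil => exact h.elim
    | cons q ρ => simp [ih q ρ h.2]

theorem hasRun_iff' (Δ : Q → A → Q → Prop) (p : Q) (w : List A) (q : Q) :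
    HasRun Δ p w q ↔ ∃ ρ, RunFrom Δ p w ρ ∧ endSt p ρ = q := by
  simp only [HasRun, endSt_eq]

theorem hasRun_nil (Δ : Q → A → Q → Prop) (p q : Q) : HasRun Δ p [] q ↔ p = q := by
  rw [hasRun_iff']
  constructor
  · rintro ⟨ρ, h1, h2⟩
    cases ρ with
    | nil => exact h2
    | cons _ _ => exact h1.elim
  · rintro rfl; exact ⟨[], trivial, rfl⟩

theorem hasRun_cons (Δ : Q → A → Q → Prop) (p q : Q) (a : A) (w : List A) :
    HasRun Δ p (a :: w) q ↔ ∃ r, Δ p a r ∧ HasRun Δ r w q := by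
  simp only [hasRun_iff']
  constructor
  · rintro ⟨ρ, h1, h2⟩
    cases ρ with
    | nil => exact h1.elim
    | cons r ρ => exact ⟨r, h1.1, ρ, h1.2, h2⟩
  · rintro ⟨r, h1, ρ, h2, h3⟩; exact ⟨r :: ρ, ⟨h1, h2⟩, h3⟩

theorem hasRun_append (Δ : Q → A → Q → Prop) (p q : Q) (w v : List A) :
    HasRun Δ p (w ++ v) q ↔ ∃ r, HasRun Δ p w r ∧ HasRun Δ r v q := by
  induction w generalizing p with
  | nil => simp [hasRun_nil]
  | cons a w ih =>
    simp only [List.cons_append, hasRun_cons, ih]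
    constructor
    · rintro ⟨r, h1, s, h2, h3⟩; exact ⟨s, ⟨r, h1, h2⟩, h3⟩
    · rintro ⟨s, ⟨r, h1, h2⟩, h3⟩; exact ⟨r, h1, s, h2, h3⟩

variable [Fintype Q] [DecidableEq Q]

theorem wMat_nil (Δ : Q → A → Q → Prop) : wMat Δ [] = 1 := rfl

theorem wMat_cons (Δ : Q → A → Q → Prop) (a : A) (w : List A) :
    wMat Δ (a :: w) = letMat Δ a * wMat Δ w := by simp [wMat]

theorem wMat_append (Δ : Q → A → Q → Prop) (v w : List A) :
    wMat Δ (v ++ w) = wMat Δ v * wMat Δ w := by simp [wMat]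

theorem wMat_wpow (Δ : Q → A → Q → Prop) (u : List A) (n : ℕ) :
    wMat Δ (wpow u n) = wMat Δ u ^ n := by
  induction n with
  | zero => rfl
  | succ n ih =>
    have : wpow u (n + 1) = u ++ wpow u n := by simp [wpow, List.replicate_succ]
    rw [this, wMat_append, ih, pow_succ']

theorem le_mul_entry (M N : Matrix Q Q ℕ) (x y z : Q) : M x y * N y z ≤ (M * N) x z := by
  rw [Matrix.mul_apply]
  exact Finset.single_le_sum (f := fun y => M x y * N y z) (fun _ _ => Nat.zero_le _)
    (Finset.mem_univ y)

theorem mul_entry_ne (M N : Matrix Q Q ℕ) (x z : Q) :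
    (M * N) x z ≠ 0 ↔ ∃ y, M x y ≠ 0 ∧ N y z ≠ 0 := by
  rw [Matrix.mul_apply, Ne, Finset.sum_eq_zero_iff]
  simp

theorem wMat_ne (Δ : Q → A → Q → Prop) (p q : Q) (w : List A) :
    wMat Δ w p q ≠ 0 ↔ HasRun Δ p w q := by
  induction w generalizing p with
  | nil => simp [hasRun_nil, wMat_nil, Matrix.one_apply]
  | cons a w ih => rw [wMat_cons, mul_entry_ne, hasRun_cons]; simp [ih, letMat]

/-! ### Matrix facts -/

theorem pow_add_ne (U : Matrix Q Q ℕ) (i j : ℕ) (x y z : Q) (h1 : (U ^ i) x y ≠ 0)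
    (h2 : (U ^ j) y z ≠ 0) : (U ^ (i + j)) x z ≠ 0 := by
  rw [pow_add, mul_entry_ne]; exact ⟨y, h1, h2⟩

theorem pow_path (U : Matrix Q Q ℕ) (n : ℕ) (p x : Q) (h : (U ^ n) p x ≠ 0) :
    ∃ s : ℕ → Q, s 0 = p ∧ s n = x ∧ ∀ i j, i ≤ j → j ≤ n → (U ^ (j - i)) (s i) (s j) ≠ 0 := by
  induction n generalizing x with
  | zero =>
    refine ⟨fun _ => p, rfl, ?_, ?_⟩
    · by_contra hne; simp [Matrix.one_apply, hne] at h
    · intro i j _ hj; simp [Nat.le_zero.1 hj]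
  | succ n ih =>
    rw [pow_succ, mul_entry_ne] at h
    obtain ⟨y, h1, h2⟩ := h
    obtain ⟨s, hs0, hsn, hs⟩ := ih y h1
    refine ⟨fun i => if i ≤ n then s i else x, by simp [hs0], by simp, ?_⟩
    intro i j hij hj
    by_cases hjn : j ≤ n
    · simpa [hjn, hij.trans hjn] using hs i j hij hjn
    · obtain rfl : j = n + 1 := by omega
      by_cases hin : i ≤ n
      · have h3 := hs i n hin le_rfl
        rw [hsn] at h3
        have h4 := pow_add_ne U (n - i) 1 (s i) y x h3 (by simpa using h2)
        rw [show n + 1 - i = n - i + 1 by omega]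
        simpa [hin] using h4
      · obtain rfl : i = n + 1 := by omega
        simp

theorem pow_cycle (U : Matrix Q Q ℕ) (n : ℕ) (hn : Fintype.card Q ≤ n) (p x : Q)
    (h : (U ^ n) p x ≠ 0) :
    ∃ r i j k, 1 ≤ i ∧ (U ^ j) p r ≠ 0 ∧ (U ^ i) r r ≠ 0 ∧ (U ^ k) r x ≠ 0 := by
  obtain ⟨s, hs0, hsn, hs⟩ := pow_path U n p x h
  obtain ⟨a, b, hab, hs'⟩ := Fintype.exists_ne_map_eq_of_card_lt
    (fun i : Fin (n + 1) => s i) (by simp; omega)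
  have key : ∀ a b : ℕ, a < b → b ≤ n → s a = s b →
      ∃ r i j k, 1 ≤ i ∧ (U ^ j) p r ≠ 0 ∧ (U ^ i) r r ≠ 0 ∧ (U ^ k) r x ≠ 0 := by
    intro a b hab hb he
    refine ⟨s a, b - a, a, n - a, by omega, ?_, ?_, ?_⟩
    · have := hs 0 a (Nat.zero_le _) (by omega)
      rwa [hs0] at this
    · have := hs a b hab.le hb
      rwa [← he] at this
    · have := hs a n (by omega) le_rfl
      rwa [hsn] at this
  rcases lt_or_gt_of_ne (fun h => hab (Fin.ext h) : (a : ℕ) ≠ b) with h | h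
  · exact key a b h (by omega) hs'
  · exact key b a h (by omega) hs'.symm

theorem ida_growth (V : Matrix Q Q ℕ) (p q : Q) (hpq : p ≠ q) (h1 : V p p ≠ 0)
    (h2 : V p q ≠ 0) (h3 : V q q ≠ 0) (n : ℕ) : n ≤ (V ^ n) p q ∧ (V ^ n) q q ≠ 0 := by
  induction n with
  | zero => simp
  | succ n ih =>
    rw [pow_succ']
    constructor
    · rw [Matrix.mul_apply]
      calc n + 1 ≤ V p p * (V ^ n) p q + V p q * (V ^ n) q q := by
            have := Nat.mul_pos (Nat.pos_of_ne_zero h2) (Nat.pos_of_ne_zero ih.2)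
            have := Nat.le_mul_of_pos_left ((V ^ n) p q) (Nat.pos_of_ne_zero h1)
            omega
        _ = ∑ y ∈ {p, q}, V p y * (V ^ n) y q := by rw [Finset.sum_pair hpq]
        _ ≤ _ := Finset.sum_le_sum_of_subset (Finset.subset_univ _)
    · rw [mul_entry_ne]; exact ⟨q, h3, ih.2⟩

theorem diag_growth (V : Matrix Q Q ℕ) (p : Q) (n : ℕ) : V p p ^ n ≤ (V ^ n) p p := by
  induction n with
  | zero => simp
  | succ n ih =>
    rw [pow_succ, pow_succ]
    exact (Nat.mul_le_mul_right _ ih).trans (le_mul_entry _ _ _ _ _)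

theorem diag_le_one (U : Matrix Q Q ℕ) (K : ℕ) (hb : ∀ n x y, (U ^ n) x y ≤ K) (x : Q) :
    U x x ≤ 1 := by
  by_contra h
  have h1 : 2 ^ K ≤ U x x ^ K := Nat.pow_le_pow_left (by omega) _
  have h2 := diag_growth U x K
  have h3 := hb K x x
  have h4 := Nat.lt_two_pow_self (n := K)
  omega

theorem cyc_eq (U : Matrix Q Q ℕ) (K : ℕ) (hb : ∀ n x y, (U ^ n) x y ≤ K) (m : ℕ)
    (ha : ∀ x y, (U ^ m) x y ≠ 0 ↔ (U ^ (m + 1)) x y ≠ 0) (r r' : Q) (i j k : ℕ)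
    (hi : 1 ≤ i) (hj : 1 ≤ j) (h1 : (U ^ i) r r ≠ 0) (h2 : (U ^ j) r' r' ≠ 0)
    (h3 : (U ^ k) r r' ≠ 0) : r = r' := by
  by_contra hne
  have ha' : ∀ d x y, (U ^ m) x y ≠ 0 ↔ (U ^ (m + d)) x y ≠ 0 := by
    intro d
    induction d with
    | zero => simp
    | succ d ih =>
      intro x y
      have e1 : U ^ (m + (d + 1)) = U ^ (m + d) * U := by rw [← add_assoc, pow_succ]
      rw [ha, e1, pow_succ, mul_entry_ne, mul_entry_ne]
      simp only [ih]
  have cyc : ∀ (s : Q) (i : ℕ), 1 ≤ i → (U ^ i) s s ≠ 0 → ∀ d, (U ^ (m + d)) s s ≠ 0 := by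
    intro s i hi h d
    rw [← ha' d]
    have h5 : (U ^ (i * m)) s s ≠ 0 := by
      rw [pow_mul]
      have := diag_growth (U ^ i) s m
      have := Nat.pow_pos (n := m) (Nat.pos_of_ne_zero h)
      omega
    have h6 : i * m = m + (i - 1) * m := by
      obtain ⟨i, rfl⟩ := Nat.exists_eq_add_of_le hi
      simp [add_mul]
    rw [h6] at h5
    exact (ha' _ _ _).2 h5
  have h4 := (ida_growth (U ^ (m + k)) r r' hne (cyc r i hi h1 k)
    (pow_add_ne U m k r r r' (cyc r i hi h1 0) h3) (cyc r' j hj h2 k) (K + 1)).1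
  rw [← pow_mul] at h4
  have := hb ((m + k) * (K + 1)) r r'
  omega

theorem mid_eq (U : Matrix Q Q ℕ) (K : ℕ) (hb : ∀ n x y, (U ^ n) x y ≤ K) (m : ℕ)
    (ha : ∀ x y, (U ^ m) x y ≠ 0 ↔ (U ^ (m + 1)) x y ≠ 0) (a b : ℕ)
    (hca : Fintype.card Q ≤ a) (hcb : Fintype.card Q ≤ b) (p x y q : Q)
    (h1 : (U ^ a) p x ≠ 0) (h2 : U x y ≠ 0) (h3 : (U ^ b) y q ≠ 0) : x = y := by
  obtain ⟨r, i, _, k, hi, _, hr, hrx⟩ := pow_cycle U a hca p x h1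
  obtain ⟨r', i', k', _, hi', hyr, hr', _⟩ := pow_cycle U b hcb y q h3
  have h2' : (U ^ 1) x y ≠ 0 := by simpa using h2
  have h4 := pow_add_ne U k 1 r x y hrx h2'
  have h5 := pow_add_ne U _ _ r y r' h4 hyr
  obtain rfl := cyc_eq U K hb m ha r r' i i' _ hi hi' hr hr' h5
  have hx := pow_add_ne U _ _ x y x h2' (pow_add_ne U _ _ y r x hyr hrx)
  have hy := pow_add_ne U _ _ y r y hyr h4
  exact cyc_eq U K hb m ha x y _ _ 1 (by omega) (by omega) hx hy h2'

theorem stab_entry (U : Matrix Q Q ℕ) (K : ℕ) (hb : ∀ n x y, (U ^ n) x y ≤ K) (m : ℕ)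
    (ha : ∀ x y, (U ^ m) x y ≠ 0 ↔ (U ^ (m + 1)) x y ≠ 0) (c : ℕ)
    (hc : Fintype.card Q ≤ c) (p x q : Q) (h1 : (U ^ c) p x ≠ 0) :
    (U ^ (c + 2)) x q = (U ^ (c + 1)) x q := by
  have e : (U ^ (c + 2)) x q = U x x * (U ^ (c + 1)) x q := by
    rw [show c + 2 = (c + 1) + 1 by ring, pow_succ' U (c + 1), Matrix.mul_apply]
    apply Finset.sum_eq_single x
    · intro y _ hy
      by_contra h
      rw [mul_eq_zero, not_or] at h
      exact hy (mid_eq U K hb m ha c (c + 1) hc (by omega) p x y q h1 h.1 h.2).symm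
    · simp
  rw [e]
  by_cases h : (U ^ (c + 1)) x q = 0
  · simp [h]
  · have h' := h
    rw [pow_succ', ← Ne, mul_entry_ne] at h'
    obtain ⟨y, hy1, hy2⟩ := h'
    obtain rfl := mid_eq U K hb m ha c c hc hc p x y q h1 hy1 hy2
    have := diag_le_one U K hb x
    rw [show U x x = 1 by omega, one_mul]

theorem stab_vec (U : Matrix Q Q ℕ) (K : ℕ) (hb : ∀ n x y, (U ^ n) x y ≤ K) (m : ℕ)
    (ha : ∀ x y, (U ^ m) x y ≠ 0 ↔ (U ^ (m + 1)) x y ≠ 0) (c : ℕ)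
    (hc : Fintype.card Q ≤ c) (p : Q) (v : Q → ℕ) (hv : ∀ x, v x ≤ (U ^ c) p x) :
    Matrix.vecMul v (U ^ (c + 2)) = Matrix.vecMul v (U ^ (c + 1)) := by
  ext q
  simp only [Matrix.vecMul, dotProduct]
  refine Finset.sum_congr rfl fun x _ => ?_
  by_cases h : v x = 0
  · simp [h]
  · rw [stab_entry U K hb m ha c hc p x q (by have := hv x; omega)]

theorem stab_mat (U : Matrix Q Q ℕ) (K : ℕ) (hb : ∀ n x y, (U ^ n) x y ≤ K) (m : ℕ)
    (ha : ∀ x y, (U ^ m) x y ≠ 0 ↔ (U ^ (m + 1)) x y ≠ 0) (c : ℕ)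
    (hc : Fintype.card Q ≤ c) : U ^ (c + (c + 2)) = U ^ (c + (c + 1)) := by
  ext p q
  rw [pow_add U c (c + 2), pow_add U c (c + 1), Matrix.mul_apply, Matrix.mul_apply]
  refine Finset.sum_congr rfl fun x _ => ?_
  by_cases h : (U ^ c) p x = 0
  · simp [h]
  · rw [stab_entry U K hb m ha c hc p x q h]

theorem loop_vec (U : Matrix Q Q ℕ) (K : ℕ) (hb : ∀ n x y, (U ^ n) x y ≤ K) (m : ℕ)
    (ha : ∀ x y, (U ^ m) x y ≠ 0 ↔ (U ^ (m + 1)) x y ≠ 0) (c : ℕ)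
    (hc : Fintype.card Q ≤ c) (p r : Q) (h1 : (U ^ c) p r ≠ 0) (v : Q → ℕ)
    (hv : ∀ x, v x + eqV x r ≤ U r x) :
    Matrix.vecMul v (U ^ (c + 1)) = 0 := by
  ext q
  simp only [Matrix.vecMul, dotProduct]
  refine Finset.sum_eq_zero fun x _ => ?_
  by_contra h
  rw [mul_eq_zero, not_or] at h
  have h2 := hv x
  have h3 := mid_eq U K hb m ha c (c + 1) hc (by omega) p r x q h1
    (by have := h.1; omega) h.2
  subst h3
  have := diag_le_one U K hb r
  simp [eqV] at h2
  have := h.1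
  omega

end Basic
section Rank
variable {Q A : Type} [Fintype Q] [DecidableEq Q]

theorem lessV_append (Δ : Q → A → Q → Prop) (e : Q → ℕ) (p : Q) (w v : List A) (ρ σ : List Q)
    (h : RunFrom Δ p w ρ) :
    lessV Δ e p (w ++ v) (ρ ++ σ) =
      Matrix.vecMul (lessV Δ e p w ρ) (wMat Δ v) + lessV Δ e (endSt p ρ) v σ := by
  induction w generalizing p ρ with
  | nil => cases ρ with
    | nil => simp [lessV, endSt]
    | cons _ _ => exact h.elim
  | cons a w ih => cases ρ with
    | nil => exact h.elim
    | cons q ρ =>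
      simp only [List.cons_append, lessV, endSt]
      rw [ih q ρ h.2, wMat_append, Matrix.add_vecMul, Matrix.vecMul_vecMul, add_assoc]

open scoped Classical in
theorem below_le_sum (e : Q → ℕ) (P : Q → Prop) (q : Q) (hq : P q) (M : Matrix Q Q ℕ) (z : Q) :
    Matrix.vecMul (belowV e P q) M z + M q z ≤ ∑ y, if P y then M y z else 0 := by
  have h : M q z = ∑ y, if y = q then M y z else 0 := by simp
  rw [h]
  simp only [Matrix.vecMul, dotProduct]
  rw [← Finset.sum_add_distrib]
  refine Finset.sum_le_sum fun y _ => ?_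
  simp only [belowV]
  by_cases hy : y = q
  · subst hy; simp [hq]
  · by_cases hP : P y <;> by_cases he : e y < e q <;> simp [hy, hP, he]

theorem below_le_below (e : Q → ℕ) (P : Q → Prop) (q q' : Q) (hq : P q) (hlt : e q < e q')
    (M : Matrix Q Q ℕ) (z : Q) :
    Matrix.vecMul (belowV e P q) M z + M q z ≤ Matrix.vecMul (belowV e P q') M z := by
  have h : M q z = ∑ y, if y = q then M y z else 0 := by simp
  rw [h]
  simp only [Matrix.vecMul, dotProduct]
  rw [← Finset.sum_add_distrib]
  refine Finset.sum_le_sum fun y _ => ?_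
  simp only [belowV]
  by_cases hy : y = q
  · subst hy; simp [hq, hlt]
  · by_cases hP : P y
    · by_cases he : e y < e q
      · simp [hy, hP, he, he.trans hlt]
      · simp [hy, he]
    · simp [hy, hP]

open scoped Classical in
theorem wMat_cons_apply (Δ : Q → A → Q → Prop) (a : A) (w : List A) (p z : Q) :
    wMat Δ (a :: w) p z = ∑ y, if Δ p a y then wMat Δ w y z else 0 := by
  rw [wMat_cons, Matrix.mul_apply]
  simp [letMat]

theorem lessV_le (Δ : Q → A → Q → Prop) (e : Q → ℕ) (p : Q) (w : List A) (ρ : List Q)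
    (h : RunFrom Δ p w ρ) (z : Q) :
    lessV Δ e p w ρ z + eqV z (endSt p ρ) ≤ wMat Δ w p z := by
  induction w generalizing p ρ with
  | nil => cases ρ with
    | nil => by_cases hz : z = p <;> simp [lessV, endSt, wMat_nil, Matrix.one_apply, eqV, hz, eq_comm]
    | cons _ _ => exact h.elim
  | cons a w ih => cases ρ with
    | nil => exact h.elim
    | cons q ρ =>
      have h1 := ih q ρ h.2
      have h2 := below_le_sum e (Δ p a) q h.1 (wMat Δ w) z
      rw [wMat_cons_apply]
      simp only [lessV, endSt, Pi.add_apply]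
      omega

/-- One of two distinct runs is strictly before the other. -/
theorem lessV_cmp (Δ : Q → A → Q → Prop) (e : Q → ℕ) (he : Function.Injective e)
    (P : Q → Prop) (w : List A) (p p' : Q) (ρ ρ' : List Q) (hp : P p) (hp' : P p')
    (h : RunFrom Δ p w ρ) (h' : RunFrom Δ p' w ρ') (hne : (p, ρ) ≠ (p', ρ')) :
    (∀ z, (Matrix.vecMul (belowV e P p) (wMat Δ w) + lessV Δ e p w ρ) z
        + eqV z (endSt p ρ)
      ≤ (Matrix.vecMul (belowV e P p') (wMat Δ w) + lessV Δ e p' w ρ') z) ∨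
    (∀ z, (Matrix.vecMul (belowV e P p') (wMat Δ w) + lessV Δ e p' w ρ') z
        + eqV z (endSt p' ρ')
      ≤ (Matrix.vecMul (belowV e P p) (wMat Δ w) + lessV Δ e p w ρ) z) := by
  induction w generalizing P p p' ρ ρ' with
  | nil =>
    cases ρ with
    | cons _ _ => exact h.elim
    | nil =>
    cases ρ' with
    | cons _ _ => exact h'.elim
    | nil =>
    have hpp : p ≠ p' := fun hh => hne (by rw [hh])
    rcases lt_or_gt_of_ne (fun hh => hpp (he hh)) with hlt | hlt
    · left; intro z
      have h1 := below_le_below e P p p' hp hlt (wMat Δ ([] : List A)) z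
      have h2 := lessV_le Δ e p [] [] h z
      simp only [Pi.add_apply]; omega
    · right; intro z
      have h1 := below_le_below e P p' p hp' hlt (wMat Δ ([] : List A)) z
      have h2 := lessV_le Δ e p' [] [] h' z
      simp only [Pi.add_apply]; omega
  | cons a w ih =>
    by_cases hpp : p = p'
    · subst hpp
      cases ρ with
      | nil => exact h.elim
      | cons q ρ =>
      cases ρ' with
      | nil => exact h'.elim
      | cons q' ρ' =>
      have := ih (Δ p a) q q' ρ ρ' h.1 h'.1 h.2 h'.2
        (fun hh => hne (by simp only [Prod.mk.injEq] at hh; rw [hh.1, hh.2]))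
      simp only [lessV, endSt, Pi.add_apply] at this ⊢
      rcases this with h3 | h3
      · left; intro z; have := h3 z; omega
      · right; intro z; have := h3 z; omega
    · rcases lt_or_gt_of_ne (fun hh => hpp (he hh)) with hlt | hlt
      · left; intro z
        have h1 := below_le_below e P p p' hp hlt (wMat Δ (a :: w)) z
        have h2 := lessV_le Δ e p _ _ h z
        simp only [Pi.add_apply]; omega
      · right; intro z
        have h1 := below_le_below e P p' p hp' hlt (wMat Δ (a :: w)) z
        have h2 := lessV_le Δ e p' _ _ h' z
        simp only [Pi.add_apply]; omega

theorem accRuns_finite (Δ : Q → A → Q → Prop) (I F : Set Q) (w : List A) :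
    (AccRuns Δ I F w).Finite := by
  refine (Set.Finite.prod (Set.finite_univ (α := Q))
    (List.finite_length_eq Q w.length)).subset ?_
  rintro ⟨p, ρ⟩ ⟨_, h, _⟩
  exact ⟨trivial, run_length Δ p w ρ h⟩

open scoped Classical in
theorem exists_runs (Δ : Q → A → Q → Prop) (F : Set Q) (w : List A) (p : Q) :
    ∃ T : Finset (List Q), (∀ ρ ∈ T, RunFrom Δ p w ρ ∧ endSt p ρ ∈ F) ∧
      T.card = ∑ f, if f ∈ F then wMat Δ w p f else 0 := by
  induction w generalizing p with
  | nil =>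
    by_cases h : p ∈ F
    · refine ⟨{[]}, ?_, ?_⟩
      · simp [RunFrom, endSt, h]
      · rw [Finset.sum_eq_single p]
        · simp [h, wMat_nil]
        · intro b _ hb; simp [wMat_nil, Matrix.one_apply, hb.symm]
        · simp
    · refine ⟨∅, by simp, ?_⟩
      symm
      simp only [Finset.card_empty]
      refine Finset.sum_eq_zero fun f _ => ?_
      by_cases hf : f = p
      · subst hf; simp [h]
      · simp [wMat_nil, Matrix.one_apply, Ne.symm hf]
  | cons a w ih =>
    choose T hT hc using ih
    refine ⟨((Finset.univ.filter (Δ p a)).sigma T).image (fun x => x.1 :: x.2), ?_, ?_⟩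
    · intro ρ hρ
      simp only [Finset.mem_image, Finset.mem_sigma, Finset.mem_filter] at hρ
      obtain ⟨⟨q, σ⟩, ⟨⟨_, h1⟩, h2⟩, rfl⟩ := hρ
      exact ⟨⟨h1, (hT q σ h2).1⟩, (hT q σ h2).2⟩
    · rw [Finset.card_image_of_injective, Finset.card_sigma]
      · simp only [hc, wMat_cons_apply]
        rw [Finset.sum_filter]
        simp only [← Finset.sum_filter (fun f => f ∈ F)]
        rw [Finset.sum_comm]
        refine Finset.sum_congr rfl fun y _ => ?_
        by_cases h : Δ p a y <;> simp [h]
      · rintro ⟨q, σ⟩ ⟨q', σ'⟩ hh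
        simp only [List.cons.injEq] at hh
        obtain ⟨rfl, rfl⟩ := hh
        rfl

open scoped Classical in
theorem count_le (Δ : Q → A → Q → Prop) (I F : Set Q) (w : List A) :
    (∑ i, if i ∈ I then (∑ f, if f ∈ F then wMat Δ w i f else 0) else 0) ≤
      (AccRuns Δ I F w).ncard := by
  choose T hT hc using exists_runs Δ F w
  let S : Finset (Q × List Q) :=
    ((Finset.univ.filter (· ∈ I)).sigma T).image (fun x => (x.1, x.2))
  have h1 : S.card = ∑ i, if i ∈ I then (∑ f, if f ∈ F then wMat Δ w i f else 0) else 0 := by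
    rw [Finset.card_image_of_injective, Finset.card_sigma, Finset.sum_filter]
    · simp only [hc]
    · rintro ⟨q, σ⟩ ⟨q', σ'⟩ hh
      simp only [Prod.mk.injEq] at hh
      obtain ⟨rfl, rfl⟩ := hh
      rfl
  rw [← h1, ← Set.ncard_coe_finset]
  refine Set.ncard_le_ncard ?_ (accRuns_finite Δ I F w)
  intro x hx
  simp only [S, Finset.coe_image, Set.mem_image, Finset.mem_coe, Finset.mem_sigma,
    Finset.mem_filter] at hx
  obtain ⟨⟨q, σ⟩, ⟨⟨_, h1⟩, h2⟩, rfl⟩ := hx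
  refine ⟨h1, (hT q σ h2).1, ?_⟩
  rw [endSt_eq]
  exact (hT q σ h2).2

theorem entry_le (Δ : Q → A → Q → Prop) (I F : Set Q) (w : List A) (i f : Q) (hi : i ∈ I)
    (hf : f ∈ F) : wMat Δ w i f ≤ (AccRuns Δ I F w).ncard := by
  classical
  refine le_trans ?_ (count_le Δ I F w)
  calc wMat Δ w i f = if f ∈ F then wMat Δ w i f else 0 := by simp [hf]
    _ ≤ ∑ f, if f ∈ F then wMat Δ w i f else 0 :=
        Finset.single_le_sum (f := fun f => if f ∈ F then wMat Δ w i f else 0)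
          (fun _ _ => Nat.zero_le _) (Finset.mem_univ f)
    _ = if i ∈ I then (∑ f, if f ∈ F then wMat Δ w i f else 0) else 0 := by simp [hi]
    _ ≤ _ := Finset.single_le_sum
          (f := fun i => if i ∈ I then (∑ f, if f ∈ F then wMat Δ w i f else 0) else 0)
          (fun _ _ => Nat.zero_le _) (Finset.mem_univ i)

open scoped Classical in
/-- Rank of an accepting run. -/
noncomputable def rankR (Δ : Q → A → Q → Prop) (e : Q → ℕ) (I F : Set Q) (w : List A)
    (x : Q × List Q) : ℕ :=
  ∑ f, if f ∈ F then
    (Matrix.vecMul (belowV e (· ∈ I) x.1) (wMat Δ w) + lessV Δ e x.1 w x.2) f else 0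

open scoped Classical in
theorem sum_F_lt (F : Set Q) (u v : Q → ℕ) (r : Q) (hr : r ∈ F)
    (h : ∀ z, u z + eqV z r ≤ v z) :
    (∑ f, if f ∈ F then u f else 0) < ∑ f, if f ∈ F then v f else 0 := by
  apply Finset.sum_lt_sum
  · intro i _
    have := h i
    split_ifs
    · omega
    · exact le_rfl
  · refine ⟨r, Finset.mem_univ _, ?_⟩
    have := h r
    simp only [eqV, if_true] at this
    simp only [hr, if_true]
    omega

theorem rankR_lt (Δ : Q → A → Q → Prop) (e : Q → ℕ) (I F : Set Q) (w : List A)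
    (x : Q × List Q) (hx : x ∈ AccRuns Δ I F w) :
    rankR Δ e I F w x < (AccRuns Δ I F w).ncard := by
  classical
  obtain ⟨h1, h2, h3⟩ := hx
  rw [endSt_eq] at h3
  refine lt_of_lt_of_le ?_ (count_le Δ I F w)
  have key := sum_F_lt F
    (Matrix.vecMul (belowV e (· ∈ I) x.1) (wMat Δ w) + lessV Δ e x.1 w x.2)
    (fun z => ∑ y, if y ∈ I then wMat Δ w y z else 0) (endSt x.1 x.2) h3 (by
      intro z
      have h4 := below_le_sum e (· ∈ I) x.1 h1 (wMat Δ w) z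
      have h5 := lessV_le Δ e x.1 w x.2 h2 z
      simp only [Pi.add_apply]
      convert_to _ ≤ (∑ y, if y ∈ I then wMat Δ w y z else 0)
      omega)
  refine lt_of_lt_of_le key (le_of_eq ?_)
  simp only [← Finset.sum_filter]
  rw [Finset.sum_comm]

theorem rankR_inj (Δ : Q → A → Q → Prop) (e : Q → ℕ) (he : Function.Injective e) (I F : Set Q)
    (w : List A) (x y : Q × List Q) (hx : x ∈ AccRuns Δ I F w) (hy : y ∈ AccRuns Δ I F w)
    (hr : rankR Δ e I F w x = rankR Δ e I F w y) : x = y := by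
  classical
  by_contra hne
  obtain ⟨h1, h2, h3⟩ := hx
  obtain ⟨h1', h2', h3'⟩ := hy
  rw [endSt_eq] at h3 h3'
  rcases lessV_cmp Δ e he (· ∈ I) w x.1 y.1 x.2 y.2 h1 h1' h2 h2' hne with h | h
  · have := sum_F_lt F _ _ _ h3 h
    simp only [rankR] at hr
    omega
  · have := sum_F_lt F _ _ _ h3' h
    simp only [rankR] at hr
    omega

end Rank
/-- Truncation at `K`. -/
def capV {Q : Type} (K : ℕ) (f : Q → ℕ) : Q → Fin (K + 1) :=
  fun y => ⟨min K (f y), by omega⟩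

/-- Forget the truncation. -/
def valV {Q : Type} {K : ℕ} (N : Q → Fin (K + 1)) : Q → ℕ := fun y => (N y : ℕ)

/-- Transition relation of the ranked automaton. -/
def bStep {Q A : Type} [Fintype Q] (Δ : Q → A → Q → Prop) (e : Q → ℕ)
    (K : ℕ) (s : Q × (Q → Fin (K + 1))) (a : A) (t : Q × (Q → Fin (K + 1))) : Prop :=
  Δ s.1 a t.1 ∧
    t.2 = capV K (Matrix.vecMul (valV s.2) (letMat Δ a) + belowV e (Δ s.1 a) t.1)

/-- Initial states of the ranked automaton. -/
def bInit {Q : Type} (e : Q → ℕ) (K : ℕ) (I : Set Q) : Set (Q × (Q → Fin (K + 1))) :=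
  {s | s.1 ∈ I ∧ s.2 = capV K (belowV e (· ∈ I) s.1)}

open scoped Classical in
/-- Final states of the ranked automaton of rank `i`. -/
def bFin {Q : Type} [Fintype Q] (K : ℕ) (F : Set Q) (i : Fin K) :
    Set (Q × (Q → Fin (K + 1))) :=
  {s | s.1 ∈ F ∧ min K (∑ f, if f ∈ F then valV s.2 f else 0) = (i : ℕ)}

/-- Projection of a run. -/
def projR {Q T : Type} (x : (Q × T) × List (Q × T)) : Q × List Q :=
  (x.1.1, x.2.map Prod.fst)

section Ranked
variable {Q A R : Type}

theorem capV_valV {K : ℕ} (N : Q → Fin (K + 1)) : capV K (valV N) = N := by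
  ext y
  have := (N y).2
  simp only [capV, valV]
  omega

theorem min_sum_congr {ι : Type} (s : Finset ι) (K : ℕ) (f g : ι → ℕ)
    (h : ∀ x, min K (f x) = min K (g x)) : min K (∑ x ∈ s, f x) = min K (∑ x ∈ s, g x) := by
  classical
  induction s using Finset.induction_on with
  | empty => simp
  | insert a s ha ih =>
    rw [Finset.sum_insert ha, Finset.sum_insert ha]
    have := h a
    omega

theorem min_mul_congr (K a b c : ℕ) (h : min K a = min K b) : min K (a * c) = min K (b * c) := by
  rcases Nat.eq_zero_or_pos c with rfl | hc
  · simp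
  · by_cases hab : a = b
    · rw [hab]
    · have h1 : K ≤ a := by omega
      have h2 : K ≤ b := by omega
      rw [min_eq_left (h1.trans (Nat.le_mul_of_pos_right _ hc)),
        min_eq_left (h2.trans (Nat.le_mul_of_pos_right _ hc))]

theorem capV_iff (K : ℕ) (f g : Q → ℕ) : capV K f = capV K g ↔ ∀ y, min K (f y) = min K (g y) := by
  simp [funext_iff, capV]

variable [Fintype Q]

theorem capV_congr (K : ℕ) (f g : Q → ℕ) (h : capV K f = capV K g) (M : Matrix Q Q ℕ)
    (v : Q → ℕ) : capV K (Matrix.vecMul f M + v) = capV K (Matrix.vecMul g M + v) := by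
  rw [capV_iff] at h ⊢
  intro y
  have := min_sum_congr Finset.univ K (fun x => f x * M x y) (fun x => g x * M x y)
    (fun x => min_mul_congr K _ _ _ (h x))
  simp only [Matrix.vecMul, dotProduct, Pi.add_apply]
  omega

theorem bRun_proj [DecidableEq Q] (Δ : Q → A → Q → Prop) (e : Q → ℕ) (K : ℕ)
    (w : List A) (p : Q) (f : Q → ℕ)
    (N : Q → Fin (K + 1)) (hN : N = capV K f) (σ : List (Q × (Q → Fin (K + 1))))
    (h : RunFrom (bStep Δ e K) (p, N) w σ) :
    RunFrom Δ p w (σ.map Prod.fst) ∧ endSt (p, N) σ = (endSt p (σ.map Prod.fst),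
      capV K (Matrix.vecMul f (wMat Δ w) + lessV Δ e p w (σ.map Prod.fst))) := by
  induction w generalizing p f N σ with
  | nil => cases σ with
    | nil => simp [RunFrom, endSt, lessV, wMat_nil, hN]
    | cons _ _ => exact h.elim
  | cons a w ih => cases σ with
    | nil => exact h.elim
    | cons t σ =>
      obtain ⟨q, N'⟩ := t
      obtain ⟨⟨h1, h2⟩, h3⟩ := h
      simp only at h1 h2
      have h4 : N' = capV K (Matrix.vecMul f (letMat Δ a) + belowV e (Δ p a) q) := by
        rw [h2]
        apply capV_congr
        rw [capV_valV, hN]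
      obtain ⟨h5, h6⟩ := ih q _ N' h4 σ h3
      refine ⟨⟨h1, h5⟩, ?_⟩
      simp only [endSt, List.map_cons, lessV]
      rw [h6, Matrix.add_vecMul, Matrix.vecMul_vecMul, ← wMat_cons, add_assoc]

theorem bRun_exists (Δ : Q → A → Q → Prop) (e : Q → ℕ) (K : ℕ)
    (w : List A) (p : Q) (N : Q → Fin (K + 1)) (ρ : List Q) (h : RunFrom Δ p w ρ) :
    ∃ σ, RunFrom (bStep Δ e K) (p, N) w σ ∧ σ.map Prod.fst = ρ := by
  induction w generalizing p N ρ with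
  | nil => cases ρ with
    | nil => exact ⟨[], trivial, rfl⟩
    | cons _ _ => exact h.elim
  | cons a w ih => cases ρ with
    | nil => exact h.elim
    | cons q ρ =>
      obtain ⟨σ, h1, h2⟩ := ih q
        (capV K (Matrix.vecMul (valV N) (letMat Δ a) + belowV e (Δ p a) q)) ρ h.2
      exact ⟨_ :: σ, ⟨⟨h.1, rfl⟩, h1⟩, by simp [h2]⟩

theorem bRun_inj (Δ : Q → A → Q → Prop) (e : Q → ℕ) (K : ℕ)
    (w : List A) (s : Q × (Q → Fin (K + 1))) (σ σ' : List (Q × (Q → Fin (K + 1))))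
    (h : RunFrom (bStep Δ e K) s w σ) (h' : RunFrom (bStep Δ e K) s w σ')
    (he : σ.map Prod.fst = σ'.map Prod.fst) : σ = σ' := by
  induction w generalizing s σ σ' with
  | nil =>
    cases σ with
    | cons _ _ => exact h.elim
    | nil =>
    cases σ' with
    | cons _ _ => exact h'.elim
    | nil => rfl
  | cons a w ih =>
    cases σ with
    | nil => exact h.elim
    | cons t σ =>
    cases σ' with
    | nil => exact h'.elim
    | cons t' σ' =>
    simp only [List.map_cons, List.cons.injEq] at he
    have ht : t = t' := by
      refine Prod.ext he.1 ?_
      rw [h.1.2, h'.1.2, he.1]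
    subst ht
    rw [ih t σ σ' h.2 h'.2 he.2]

theorem hasRun_bStep [DecidableEq Q] (Δ : Q → A → Q → Prop) (e : Q → ℕ) (K : ℕ)
    (w : List A) (p q : Q) (N N' : Q → Fin (K + 1)) :
    HasRun (bStep Δ e K) (p, N) w (q, N') ↔ ∃ ρ, RunFrom Δ p w ρ ∧ endSt p ρ = q ∧
      N' = capV K (Matrix.vecMul (valV N) (wMat Δ w) + lessV Δ e p w ρ) := by
  rw [hasRun_iff']
  constructor
  · rintro ⟨σ, h1, h2⟩
    obtain ⟨h3, h4⟩ := bRun_proj Δ e K w p (valV N) N (capV_valV N).symm σ h1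
    rw [h4, Prod.mk.injEq] at h2
    exact ⟨_, h3, h2.1, h2.2.symm⟩
  · rintro ⟨ρ, h1, h2, h3⟩
    obtain ⟨σ, h4, rfl⟩ := bRun_exists Δ e K w p N ρ h1
    obtain ⟨_, h5⟩ := bRun_proj Δ e K w p (valV N) N (capV_valV N).symm σ h4
    exact ⟨σ, h4, by rw [h5, h2, ← h3]⟩

theorem wpow_add (u : List A) (m n : ℕ) : wpow u (m + n) = wpow u m ++ wpow u n := by
  simp only [wpow, List.replicate_add, List.flatten_append]

theorem wpow_one (u : List A) : wpow u 1 = u := by simp [wpow]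

theorem bStep_aperiodic (Δ : Q → A → Q → Prop) (e : Q → ℕ) (K : ℕ) [DecidableEq Q]
    (hb : ∀ w x y, wMat Δ w x y ≤ K) (hap : Aperiodic Δ) : Aperiodic (bStep Δ e K) := by
  obtain ⟨m, _, hm⟩ := hap
  set c := Fintype.card Q with hc
  refine ⟨c + (1 + c), by omega, ?_⟩
  rintro ⟨p, N⟩ ⟨q, N'⟩ u hu
  have hbU : ∀ n x y, (wMat Δ u ^ n) x y ≤ K := by
    intro n x y; rw [← wMat_wpow]; exact hb _ _ _
  have haU : ∀ x y, (wMat Δ u ^ m) x y ≠ 0 ↔ (wMat Δ u ^ (m + 1)) x y ≠ 0 := by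
    intro x y; rw [← wMat_wpow, ← wMat_wpow, wMat_ne, wMat_ne]; exact hm x y u hu
  have hN1 : wMat Δ (wpow u (c + (1 + (1 + c)))) = wMat Δ (wpow u (c + (1 + c))) := by
    rw [wMat_wpow, wMat_wpow, show c + (1 + (1 + c)) = c + (c + 2) by ring,
      show c + (1 + c) = c + (c + 1) by ring]
    exact stab_mat _ K hbU m haU c le_rfl
  have w1 : wpow u (c + (1 + c)) = wpow u c ++ (u ++ wpow u c) := by
    rw [wpow_add, wpow_add, wpow_one]
  have w2 : wpow u (c + (1 + (1 + c))) = wpow u c ++ (u ++ (u ++ wpow u c)) := by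
    rw [wpow_add, wpow_add, wpow_add, wpow_one]
  -- the key computation
  have key : ∀ ρ₁ ρ₂ ρ₂' ρ₃, RunFrom Δ p (wpow u c) ρ₁ →
      RunFrom Δ (endSt p ρ₁) u ρ₂ → RunFrom Δ (endSt p ρ₁) u ρ₂' →
      endSt (endSt p ρ₁) ρ₂ = endSt p ρ₁ → endSt (endSt p ρ₁) ρ₂' = endSt p ρ₁ →
      lessV Δ e p (wpow u c ++ (u ++ (u ++ wpow u c))) (ρ₁ ++ (ρ₂ ++ (ρ₂' ++ ρ₃))) =
      lessV Δ e p (wpow u c ++ (u ++ wpow u c)) (ρ₁ ++ (ρ₂' ++ ρ₃)) := by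
    intro ρ₁ ρ₂ ρ₂' ρ₃ h1 h2 h2' e2 e2'
    rw [lessV_append _ _ _ _ _ _ _ h1, lessV_append _ _ _ _ _ _ _ h2,
      lessV_append _ _ _ _ _ _ _ h1, e2, lessV_append _ _ _ _ _ _ _ h2', e2']
    have a1 := stab_vec (wMat Δ u) K hbU m haU c le_rfl p (lessV Δ e p (wpow u c) ρ₁) (by
      intro x
      have := lessV_le Δ e p _ _ h1 x
      rw [wMat_wpow] at this
      omega)
    have a2 := loop_vec (wMat Δ u) K hbU m haU c le_rfl p (endSt p ρ₁) (by
      rw [← wMat_wpow, wMat_ne, hasRun_iff']; exact ⟨_, h1, rfl⟩)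
      (lessV Δ e (endSt p ρ₁) u ρ₂) (by
        intro x
        have := lessV_le Δ e _ _ _ h2 x
        rwa [e2] at this)
    have m1 : wMat Δ (u ++ wpow u c) = wMat Δ u ^ (c + 1) := by
      rw [wMat_append, wMat_wpow, pow_succ']
    have m2 : wMat Δ (u ++ (u ++ wpow u c)) = wMat Δ u ^ (c + 2) := by
      rw [wMat_append, m1, ← pow_succ']
    rw [m2, a1, m1, a2, zero_add]
  have mid : ∀ (a b : ℕ) (x y z : Q), c ≤ a → c ≤ b → HasRun Δ p (wpow u a) x →
      HasRun Δ x u y → HasRun Δ y (wpow u b) z → x = y := by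
    intro a b x y z ha hb' h1 h2 h3
    rw [← wMat_ne] at h1 h2 h3
    rw [wMat_wpow] at h1 h3
    exact mid_eq (wMat Δ u) K hbU m haU a b ha hb' p x y z h1 h2 h3
  rw [show c + (1 + c) + 1 = c + (1 + (1 + c)) by ring, hasRun_bStep, hasRun_bStep, hN1, w1, w2]
  constructor
  · rintro ⟨ρ, hρ, hq, hN⟩
    obtain ⟨ρ₁, ρ', rfl, h1, h'⟩ := (run_append ..).1 hρ
    obtain ⟨ρ₂, ρ₃, rfl, h2, h3⟩ := (run_append ..).1 h'
    have e2 : endSt p ρ₁ = endSt (endSt p ρ₁) ρ₂ := by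
      refine mid c c _ _ _ le_rfl le_rfl ((hasRun_iff' ..).2 ⟨_, h1, rfl⟩)
        ((hasRun_iff' ..).2 ⟨_, h2, rfl⟩) ((hasRun_iff' ..).2 ⟨_, h3, rfl⟩)
    refine ⟨ρ₁ ++ (ρ₂ ++ (ρ₂ ++ ρ₃)), ?_, ?_, ?_⟩
    · refine (run_append ..).2 ⟨_, _, rfl, h1, (run_append ..).2 ⟨_, _, rfl, h2, ?_⟩⟩
      rw [← e2]
      exact h'
    · rw [← hq]
      simp only [endSt_append, ← e2]
    · rw [hN, key ρ₁ ρ₂ ρ₂ ρ₃ h1 h2 h2 e2.symm e2.symm]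
  · rintro ⟨ρ, hρ, hq, hN⟩
    obtain ⟨ρ₁, ρ', rfl, h1, h'⟩ := (run_append ..).1 hρ
    obtain ⟨ρ₂, ρ'', rfl, h2, h''⟩ := (run_append ..).1 h'
    obtain ⟨ρ₂', ρ₃, rfl, h2', h3⟩ := (run_append ..).1 h''
    have e2 : endSt p ρ₁ = endSt (endSt p ρ₁) ρ₂ := by
      refine mid c (1 + c) _ _ _ le_rfl (by omega) ((hasRun_iff' ..).2 ⟨_, h1, rfl⟩)
        ((hasRun_iff' ..).2 ⟨_, h2, rfl⟩) ((hasRun_iff' ..).2 ⟨ρ₂' ++ ρ₃, ?_, rfl⟩)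
      rw [wpow_add, wpow_one]; exact h''
    rw [← e2] at h2' h3 h''
    have e2' : endSt p ρ₁ = endSt (endSt p ρ₁) ρ₂' := by
      refine mid c c _ _ _ le_rfl le_rfl ((hasRun_iff' ..).2 ⟨_, h1, rfl⟩)
        ((hasRun_iff' ..).2 ⟨_, h2', rfl⟩) ((hasRun_iff' ..).2 ⟨_, h3, rfl⟩)
    refine ⟨ρ₁ ++ (ρ₂' ++ ρ₃), ?_, ?_, ?_⟩
    · exact (run_append ..).2 ⟨_, _, rfl, h1, h''⟩
    · rw [← hq]
      simp only [endSt_append, ← e2]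
    · rw [hN, key ρ₁ ρ₂ ρ₂' ρ₃ h1 h2 h2' e2.symm e2'.symm]

theorem bAcc_proj [DecidableEq Q] (Δ : Q → A → Q → Prop) (e : Q → ℕ) (K : ℕ) (I F : Set Q)
    (i : Fin K) (w : List A) (x : (Q × (Q → Fin (K + 1))) × List (Q × (Q → Fin (K + 1)))) :
    x ∈ AccRuns (bStep Δ e K) (bInit e K I) (bFin K F i) w ↔
      x.1 ∈ bInit e K I ∧ RunFrom (bStep Δ e K) x.1 w x.2 ∧ projR x ∈ AccRuns Δ I F w ∧
        min K (rankR Δ e I F w (projR x)) = (i : ℕ) := by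
  classical
  obtain ⟨⟨p, N⟩, σ⟩ := x
  simp only [AccRuns, Set.mem_setOf_eq, endSt_eq, projR]
  refine and_congr_right fun hI => and_congr_right fun hrun => ?_
  obtain ⟨h1, h2⟩ := bRun_proj Δ e K w p _ N hI.2 σ hrun
  rw [h2]
  have hI1 : p ∈ I := hI.1
  simp only [bFin, Set.mem_setOf_eq, rankR, h1, hI1, true_and]
  refine and_congr_right fun _ => ?_
  rw [min_sum_congr]
  intro x
  by_cases hx : x ∈ F
  · simp [hx, valV, capV]
  · simp [hx]

theorem bAcc_injOn [DecidableEq Q] (Δ : Q → A → Q → Prop) (e : Q → ℕ) (K : ℕ) (I F : Set Q)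
    (i : Fin K) (w : List A) :
    Set.InjOn projR (AccRuns (bStep Δ e K) (bInit e K I) (bFin K F i) w) := by
  rintro ⟨⟨p, N⟩, σ⟩ ⟨h1, h2, _⟩ ⟨⟨p', N'⟩, σ'⟩ ⟨h1', h2', _⟩ h
  simp only [projR, Prod.mk.injEq] at h
  obtain ⟨rfl, hσ⟩ := h
  have hN : N = N' := by
    have a1 : N = _ := h1.2
    have a2 : N' = _ := h1'.2
    rw [a1, a2]
  subst hN
  rw [bRun_inj Δ e K w _ σ σ' h2 h2' hσ]

theorem wgtSeq_proj {T : Type} (wgt : Q → A → Q → R) (w : List A) (s : Q × T)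
    (σ : List (Q × T)) :
    wgtSeq (fun s a t => wgt s.1 a t.1) s w σ = wgtSeq wgt s.1 w (σ.map Prod.fst) := by
  induction w generalizing s σ with
  | nil => cases σ <;> rfl
  | cons a w ih => cases σ with
    | nil => rfl
    | cons t σ => simp [wgtSeq, ih]

theorem bAccW_image [DecidableEq Q] (Δ : Q → A → Q → Prop) (wgt : Q → A → Q → R) (e : Q → ℕ)
    (K : ℕ) (I F : Set Q)
    (hamb : ∀ w : List A, (AccRuns Δ I F w).ncard ≤ K) (i : Fin K) (w : List A) (s : List R) :
    (AccRunsW (bStep Δ e K) (fun s a t => wgt s.1 a t.1) (bInit e K I) (bFin K F i) w s).ncard =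
      {x | x ∈ AccRunsW Δ wgt I F w s ∧ rankR Δ e I F w x = (i : ℕ)}.ncard := by
  rw [← Set.ncard_image_of_injOn
    ((bAcc_injOn Δ e K I F i w).mono (fun x hx => hx.1))]
  congr 1
  ext y
  constructor
  · rintro ⟨x, ⟨hx, hs⟩, rfl⟩
    obtain ⟨_, _, h3, h4⟩ := (bAcc_proj Δ e K I F i w x).1 hx
    have h5 := rankR_lt Δ e I F w _ h3
    have h6 := hamb w
    rw [wgtSeq_proj] at hs
    exact ⟨⟨h3, hs⟩, by omega⟩
  · rintro ⟨⟨hy, hs⟩, hr⟩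
    obtain ⟨p, ρ⟩ := y
    obtain ⟨σ, h1, rfl⟩ := bRun_exists Δ e K w p (capV K (belowV e (· ∈ I) p)) ρ hy.2.1
    refine ⟨((p, capV K (belowV e (· ∈ I) p)), σ), ⟨?_, ?_⟩, rfl⟩
    · rw [bAcc_proj]
      refine ⟨⟨hy.1, rfl⟩, h1, hy, ?_⟩
      have := i.2
      simp only [projR]
      omega
    · rw [wgtSeq_proj]; exact hs

theorem core_decomposition [DecidableEq Q] (Δ : Q → A → Q → Prop) (wgt : Q → A → Q → R)
    (I F : Set Q) (K : ℕ)
    (hamb : ∀ w : List A, (AccRuns Δ I F w).ncard ≤ K) (hb : ∀ w x y, wMat Δ w x y ≤ K) :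
    ∃ (S : Type) (_ : Fintype S) (Δ' : Fin K → (S → A → S → Prop))
      (wgt' : Fin K → (S → A → S → R)) (I' F' : Fin K → Set S),
      (∀ (i : Fin K) (w : List A), (AccRuns (Δ' i) (I' i) (F' i) w).ncard ≤ 1) ∧
      (∀ w : List A, w ≠ [] → ∀ s : List R,
        (AccRunsW Δ wgt I F w s).ncard
          = ∑ i : Fin K, (AccRunsW (Δ' i) (wgt' i) (I' i) (F' i) w s).ncard) ∧
      (Aperiodic Δ → ∀ i : Fin K, Aperiodic (Δ' i)) := by
  classical
  let e : Q → ℕ := fun q => (Fintype.equivFin Q q : ℕ)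
  have he : Function.Injective e := Fin.val_injective.comp (Fintype.equivFin Q).injective
  refine ⟨Q × (Q → Fin (K + 1)), inferInstance, fun _ => bStep Δ e K,
    fun _ s a t => wgt s.1 a t.1, fun _ => bInit e K I, fun i => bFin K F i, ?_, ?_, ?_⟩
  · intro i w
    rw [Set.ncard_le_one (accRuns_finite _ _ _ _)]
    intro x hx y hy
    apply bAcc_injOn Δ e K I F i w hx hy
    obtain ⟨_, _, h3, h4⟩ := (bAcc_proj Δ e K I F i w x).1 hx
    obtain ⟨_, _, h3', h4'⟩ := (bAcc_proj Δ e K I F i w y).1 hy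
    have h5 := rankR_lt Δ e I F w _ h3
    have h5' := rankR_lt Δ e I F w _ h3'
    have h6 := hamb w
    exact rankR_inj Δ e he I F w _ _ h3 h3' (by omega)
  · intro w _ s
    simp only [bAccW_image Δ wgt e K I F hamb]
    have hfin : (AccRunsW Δ wgt I F w s).Finite :=
      (accRuns_finite Δ I F w).subset (fun x hx => hx.1)
    have hlt : ∀ x ∈ hfin.toFinset, rankR Δ e I F w x < K := by
      intro x hx
      rw [Set.Finite.mem_toFinset] at hx
      exact (rankR_lt Δ e I F w x hx.1).trans_le (hamb w)
    rw [Set.ncard_eq_toFinset_card _ hfin,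
      Finset.card_eq_sum_card_fiberwise (f := rankR Δ e I F w) (t := Finset.range K)
        (fun x hx => by simpa using hlt x hx), Finset.sum_range]
    refine Finset.sum_congr rfl fun i _ => ?_
    rw [← Set.ncard_coe_finset]
    congr 1
    ext x
    simp
  · intro hap i
    exact bStep_aperiodic Δ e K hb hap

/-! ### Trimming -/

theorem trim_facts [DecidableEq Q] (Δ : Q → A → Q → Prop) (I F : Set Q) (K : ℕ) (hK : 1 ≤ K)
    (hamb : ∀ w : List A, (AccRuns Δ I F w).ncard ≤ K) :
    ∃ D : Q → A → Q → Prop, (∀ w, AccRuns D I F w = AccRuns Δ I F w) ∧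
      (∀ w x y, wMat D w x y ≤ K) ∧ (Aperiodic Δ → Aperiodic D) := by
  classical
  let acc : Q → Prop := fun p => ∃ w, ∃ i ∈ I, HasRun Δ i w p
  let coacc : Q → Prop := fun q => ∃ w, ∃ f ∈ F, HasRun Δ q w f
  let D : Q → A → Q → Prop := fun p a q => Δ p a q ∧ acc p ∧ coacc q
  have acc_step : ∀ p a q, acc p → Δ p a q → acc q := by
    rintro p a q ⟨w, i, hi, h⟩ hd
    exact ⟨w ++ [a], i, hi, (hasRun_append ..).2 ⟨p, h, (hasRun_cons ..).2
      ⟨q, hd, (hasRun_nil ..).2 rfl⟩⟩⟩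
  have coacc_back : ∀ p w q, coacc q → HasRun Δ p w q → coacc p := by
    rintro p w q ⟨v, f, hf, h⟩ hr
    exact ⟨w ++ v, f, hf, (hasRun_append ..).2 ⟨q, hr, h⟩⟩
  have run_up : ∀ (w : List A) (p : Q) (ρ : List Q), acc p → coacc (endSt p ρ) →
      RunFrom Δ p w ρ → RunFrom D p w ρ := by
    intro w
    induction w with
    | nil => intro p ρ _ _ h
             cases ρ with
             | nil => trivial
             | cons _ _ => exact h.elim
    | cons a w ih =>
      intro p ρ hp hc h
      cases ρ with
      | nil => exact h.elim
      | cons q ρ =>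
        refine ⟨⟨h.1, hp, ?_⟩, ih q ρ (acc_step p a q hp h.1) hc h.2⟩
        exact coacc_back q w _ hc ((hasRun_iff' ..).2 ⟨ρ, h.2, rfl⟩)
  have run_down : ∀ (w : List A) (p : Q) (ρ : List Q), RunFrom D p w ρ → RunFrom Δ p w ρ := by
    intro w
    induction w with
    | nil => intro p ρ h
             cases ρ with
             | nil => trivial
             | cons _ _ => exact h.elim
    | cons a w ih =>
      intro p ρ h
      cases ρ with
      | nil => exact h.elim
      | cons q ρ => exact ⟨h.1.1, ih q ρ h.2⟩
  have ends : ∀ (w : List A) (p q : Q), w ≠ [] → HasRun D p w q → acc p ∧ coacc q := by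
    intro w
    induction w with
    | nil => intro p q h; exact (h rfl).elim
    | cons a w ih =>
      intro p q _ h
      obtain ⟨r, h1, h2⟩ := (hasRun_cons ..).1 h
      refine ⟨h1.2.1, ?_⟩
      by_cases hw : w = []
      · subst hw
        rw [hasRun_nil] at h2
        exact h2 ▸ h1.2.2
      · exact (ih r q hw h2).2
  have hasD : ∀ (w : List A) (p q : Q), w ≠ [] →
      (HasRun D p w q ↔ acc p ∧ coacc q ∧ HasRun Δ p w q) := by
    intro w p q hw
    constructor
    · intro h
      obtain ⟨h1, h2⟩ := ends w p q hw h
      obtain ⟨ρ, h3, h4⟩ := (hasRun_iff' ..).1 h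
      exact ⟨h1, h2, (hasRun_iff' ..).2 ⟨ρ, run_down w p ρ h3, h4⟩⟩
    · rintro ⟨h1, h2, h⟩
      obtain ⟨ρ, h3, h4⟩ := (hasRun_iff' ..).1 h
      exact (hasRun_iff' ..).2 ⟨ρ, run_up w p ρ h1 (h4 ▸ h2) h3, h4⟩
  refine ⟨D, ?_, ?_, ?_⟩
  · intro w
    ext ⟨p, ρ⟩
    simp only [AccRuns, Set.mem_setOf_eq, endSt_eq]
    constructor
    · rintro ⟨h1, h2, h3⟩; exact ⟨h1, run_down w p ρ h2, h3⟩
    · rintro ⟨h1, h2, h3⟩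
      exact ⟨h1, run_up w p ρ ⟨[], p, h1, (hasRun_nil ..).2 rfl⟩
        ⟨[], _, h3, (hasRun_nil ..).2 rfl⟩ h2, h3⟩
  · have mono : ∀ (w : List A) (x y : Q), wMat D w x y ≤ wMat Δ w x y := by
      intro w
      induction w with
      | nil => intro x y; simp [wMat_nil]
      | cons a w ih =>
        intro x y
        rw [wMat_cons_apply, wMat_cons_apply]
        refine Finset.sum_le_sum fun z _ => ?_
        by_cases h : D x a z
        · rw [if_pos h, if_pos h.1]; exact ih z y
        · simp [h]
    intro w x y
    by_cases h0 : wMat D w x y = 0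
    · omega
    by_cases hw : w = []
    · subst hw
      rw [wMat_nil, Matrix.one_apply]
      split_ifs <;> omega
    obtain ⟨⟨w1, i, hi, h1⟩, ⟨w2, f, hf, h2⟩⟩ := ends w x y hw ((wMat_ne ..).1 h0)
    rw [← wMat_ne] at h1 h2
    have h3 := (entry_le Δ I F (w1 ++ (w ++ w2)) i f hi hf).trans (hamb _)
    rw [wMat_append, wMat_append] at h3
    have h4 := le_mul_entry (wMat Δ w1) (wMat Δ w * wMat Δ w2) i x f
    have h5 := le_mul_entry (wMat Δ w) (wMat Δ w2) x y f
    calc wMat D w x y ≤ wMat Δ w x y := mono w x y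
      _ ≤ wMat Δ w x y * wMat Δ w2 y f := Nat.le_mul_of_pos_right _ (Nat.pos_of_ne_zero h2)
      _ ≤ _ := h5
      _ ≤ wMat Δ w1 i x * (wMat Δ w * wMat Δ w2) x f :=
          Nat.le_mul_of_pos_left _ (Nat.pos_of_ne_zero h1)
      _ ≤ _ := h4
      _ ≤ K := h3
  · rintro ⟨m, hm1, hm⟩
    refine ⟨m, hm1, fun p q u hu => ?_⟩
    have hne : ∀ n, 1 ≤ n → wpow u n ≠ [] := by
      intro n hn
      obtain ⟨k, rfl⟩ := Nat.exists_eq_add_of_le hn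
      rw [wpow_add, wpow_one]
      simp [hu]
    rw [hasD _ p q (hne m hm1), hasD _ p q (hne (m + 1) (by omega)), hm p q u hu]

end Ranked

/-- Every `K`-ambiguous weighted automaton over an arbitrary weight set decomposes into
`K` unambiguous weighted automata whose disjoint union has the same abstract semantics
(the multiset of weight sequences of accepting runs, expressed here by counting, for
every weight sequence, the accepting runs realizing it); moreover if the original
automaton is aperiodic the pieces can be chosen aperiodic. -/
theorem kAmbiguous_decomposition {Q A R : Type} [Fintype Q]
    (Δ : Q → A → Q → Prop) (wgt : Q → A → Q → R) (I F : Set Q)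
    (K : ℕ) (hK : 1 ≤ K)
    (hamb : ∀ w : List A, (AccRuns Δ I F w).ncard ≤ K) :
    ∃ (S : Type) (_ : Fintype S) (Δ' : Fin K → (S → A → S → Prop))
      (wgt' : Fin K → (S → A → S → R)) (I' F' : Fin K → Set S),
      (∀ (i : Fin K) (w : List A), (AccRuns (Δ' i) (I' i) (F' i) w).ncard ≤ 1) ∧
      (∀ w : List A, w ≠ [] → ∀ s : List R,
        (AccRunsW Δ wgt I F w s).ncard
          = ∑ i : Fin K, (AccRunsW (Δ' i) (wgt' i) (I' i) (F' i) w s).ncard) ∧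
      (Aperiodic Δ → ∀ i : Fin K, Aperiodic (Δ' i)) := by
  classical
  obtain ⟨D, h1, h2, h3⟩ := trim_facts Δ I F K hK hamb
  obtain ⟨S, hS, Δ', wgt', I', F', k1, k2, k3⟩ :=
    core_decomposition D wgt I F K (fun w => by rw [h1]; exact hamb w) h2
  refine ⟨S, hS, Δ', wgt', I', F', k1, ?_, fun hap => k3 (h3 hap)⟩
  intro w hw s
  rw [← k2 w hw s]
  simp only [AccRunsW, h1]
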